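/- arXiv:2410.08736 — 3 statements merged into one kernel-verified Lean document; each statement's English description precedes it below -/
import Mathlib

section
/- Let D ⊆ ℂⁿ be open, let v : D → ℝ be pluriharmonic of class C², and let δ : D → ℝ be strictly plurisubharmonic of class C². Then for every open set E whose closure is compact and contained in D, there exists ε₀ > 0 such that the function z ↦ e^{v(z)}·θ(δ(z)) is plurisubharmonic on E ∩ {z : δ(z) < ε₀}. -/
open Complex

/-- Levi form of a real-valued function on a complex normed space:
`L_f(p; a) = (1/4)(D²f(p)(a,a) + D²f(p)(i·a, i·a))`. -/
noncomputable def leviForm {E : Type*} [NormedAddCommGroup E] [NormedSpace ℂ E]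
    (f : E → ℝ) (p a : E) : ℝ :=
  (1 / 4) * (iteratedFDeriv ℝ 2 f p ![a, a] +
    iteratedFDeriv ℝ 2 f p ![Complex.I • a, Complex.I • a])

/-- Directional Wirtinger derivative `∂_a g(p)` of a complex-valued function. -/
noncomputable def wirtDerivC {E : Type*} [NormedAddCommGroup E] [NormedSpace ℂ E]
    (g : E → ℂ) (p a : E) : ℂ :=
  (1 / 2) * (fderiv ℝ g p a - Complex.I * fderiv ℝ g p (Complex.I • a))

/-- Directional Wirtinger derivative `∂_a g(p)` of a real-valued function. -/
noncomputable def wirtDerivR {E : Type*} [NormedAddCommGroup E] [NormedSpace ℂ E]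
    (g : E → ℝ) (p a : E) : ℂ :=
  (1 / 2) * ((fderiv ℝ g p a : ℂ) - Complex.I * (fderiv ℝ g p (Complex.I • a) : ℂ))

open Topology

section SecondDerivative

variable {F : Type*} [NormedAddCommGroup F] [NormedSpace ℝ F]

theorem ContDiffAt.eventually_differentiableAt {f : F → ℝ} {p : F} (hf : ContDiffAt ℝ 2 f p) :
    ∀ᶠ z in 𝓝 p, DifferentiableAt ℝ f z :=
  (hf.eventually (by simp)).mono fun _ hz => hz.differentiableAt (by simp)

theorem ContDiffAt.differentiableAt_fderiv {f : F → ℝ} {p : F} (hf : ContDiffAt ℝ 2 f p) :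
    DifferentiableAt ℝ (fderiv ℝ f) p :=
  (hf.fderiv_right (m := 1) (by norm_num)).differentiableAt (by simp)

theorem fderiv_fderiv_mul_apply_self {f g : F → ℝ} {p : F} (hf : ContDiffAt ℝ 2 f p)
    (hg : ContDiffAt ℝ 2 g p) (a : F) :
    fderiv ℝ (fderiv ℝ fun z => f z * g z) p a a =
      f p * fderiv ℝ (fderiv ℝ g) p a a + 2 * (fderiv ℝ f p a * fderiv ℝ g p a)
        + g p * fderiv ℝ (fderiv ℝ f) p a a := by
  have h : fderiv ℝ (fun z => f z * g z) =ᶠ[𝓝 p]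
      fun z => f z • fderiv ℝ g z + g z • fderiv ℝ f z := by
    filter_upwards [hf.eventually_differentiableAt, hg.eventually_differentiableAt] with z h₁ h₂
    exact fderiv_fun_mul h₁ h₂
  have hf' := hf.eventually_differentiableAt.self_of_nhds.hasFDerivAt
  have hg' := hg.eventually_differentiableAt.self_of_nhds.hasFDerivAt
  rw [h.fderiv_eq, ((hf'.fun_smul hg.differentiableAt_fderiv.hasFDerivAt).fun_add
    (hg'.fun_smul hf.differentiableAt_fderiv.hasFDerivAt)).fderiv]
  simp
  ring

theorem fderiv_fderiv_comp_apply_self {φ φ' : ℝ → ℝ} {φ'' : ℝ} {f : F → ℝ} {p : F}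
    (hφ : ∀ x, HasDerivAt φ (φ' x) x) (hφ' : HasDerivAt φ' φ'' (f p))
    (hf : ContDiffAt ℝ 2 f p) (a : F) :
    fderiv ℝ (fderiv ℝ fun z => φ (f z)) p a a =
      φ' (f p) * fderiv ℝ (fderiv ℝ f) p a a + φ'' * fderiv ℝ f p a ^ 2 := by
  have h : fderiv ℝ (fun z => φ (f z)) =ᶠ[𝓝 p] fun z => φ' (f z) • fderiv ℝ f z := by
    filter_upwards [hf.eventually_differentiableAt] with z hz
    exact ((hφ _).comp_hasFDerivAt z hz.hasFDerivAt).fderiv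
  have hf' := hf.eventually_differentiableAt.self_of_nhds.hasFDerivAt
  have h' : HasFDerivAt (fun z => φ' (f z)) (φ'' • fderiv ℝ f p) p := hφ'.comp_hasFDerivAt p hf'
  rw [h.fderiv_eq, (h'.fun_smul hf.differentiableAt_fderiv.hasFDerivAt).fderiv]
  simp
  ring

end SecondDerivative

namespace expNegInvGlue

theorem hasDerivAt (x : ℝ) : HasDerivAt expNegInvGlue (x⁻¹ ^ 2 * expNegInvGlue x) x := by
  simpa using hasDerivAt_polynomial_eval_inv_mul 1 x

theorem hasDerivAt_deriv (x : ℝ) : HasDerivAt (fun x => x⁻¹ ^ 2 * expNegInvGlue x)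
    (x⁻¹ ^ 2 * (x⁻¹ ^ 2 - 2 * x⁻¹) * expNegInvGlue x) x := by
  simpa [one_add_one_eq_two] using hasDerivAt_polynomial_eval_inv_mul (Polynomial.X ^ (2 : ℕ)) x

end expNegInvGlue

section LeviForm

variable {V : Type*} [NormedAddCommGroup V] [NormedSpace ℂ V]

theorem leviForm_eq_fderiv (f : V → ℝ) (p a : V) :
    leviForm f p a = (1 / 4) * (fderiv ℝ (fderiv ℝ f) p a a +
      fderiv ℝ (fderiv ℝ f) p (I • a) (I • a)) := by
  simp [leviForm, iteratedFDeriv_two_apply]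

theorem leviForm_real_smul (f : V → ℝ) (p a : V) (t : ℝ) :
    leviForm f p (t • a) = t ^ 2 * leviForm f p a := by
  simp only [leviForm_eq_fderiv, smul_comm I t a, map_smul, smul_apply,
    smul_eq_mul]
  ring

theorem leviForm_exp_mul_expNegInvGlue {v δ : V → ℝ} {p : V} (hv : ContDiffAt ℝ 2 v p)
    (hδ : ContDiffAt ℝ 2 δ p) (a : V) :
    leviForm (fun z => Real.exp (v z) * expNegInvGlue (δ z)) p a =
      Real.exp (v p) * expNegInvGlue (δ p) *
        (leviForm v p a + (δ p)⁻¹ ^ 2 * leviForm δ p a +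
          (1 / 4) * (fderiv ℝ v p a ^ 2 + fderiv ℝ v p (I • a) ^ 2 +
            (δ p)⁻¹ ^ 2 * ((δ p)⁻¹ ^ 2 - 2 * (δ p)⁻¹) *
              (fderiv ℝ δ p a ^ 2 + fderiv ℝ δ p (I • a) ^ 2) +
            2 * (δ p)⁻¹ ^ 2 * (fderiv ℝ v p a * fderiv ℝ δ p a +
              fderiv ℝ v p (I • a) * fderiv ℝ δ p (I • a)))) := by
  have hθ : ContDiffAt ℝ 2 (fun z => expNegInvGlue (δ z)) p :=
    (expNegInvGlue.contDiff (n := 2)).contDiffAt.comp p hδ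
  have hdv := hv.eventually_differentiableAt.self_of_nhds.hasFDerivAt
  have hdδ := hδ.eventually_differentiableAt.self_of_nhds.hasFDerivAt
  have h₁ : fderiv ℝ (fun z => Real.exp (v z)) p = Real.exp (v p) • fderiv ℝ v p := hdv.exp.fderiv
  have h₂ : fderiv ℝ (fun z => expNegInvGlue (δ z)) p =
      ((δ p)⁻¹ ^ 2 * expNegInvGlue (δ p)) • fderiv ℝ δ p :=
    ((expNegInvGlue.hasDerivAt _).comp_hasFDerivAt p hdδ).fderiv
  simp only [leviForm_eq_fderiv, fderiv_fderiv_mul_apply_self hv.exp hθ,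
    fderiv_fderiv_comp_apply_self Real.hasDerivAt_exp (Real.hasDerivAt_exp _) hv,
    fderiv_fderiv_comp_apply_self expNegInvGlue.hasDerivAt
      (expNegInvGlue.hasDerivAt_deriv _) hδ, h₁, h₂, smul_apply, smul_eq_mul]
  ring

theorem exists_sq_fderiv_le_mul_leviForm [ProperSpace V] {D K : Set V} (hD : IsOpen D)
    {v δ : V → ℝ} (hv : ContDiffOn ℝ 2 v D) (hδ : ContDiffOn ℝ 2 δ D)
    (hpos : ∀ p ∈ D, ∀ a : V, a ≠ 0 → 0 < leviForm δ p a) (hK : IsCompact K) (hKD : K ⊆ D) :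
    ∃ M : ℝ, 0 < M ∧ ∀ p ∈ K, ∀ a : V,
      fderiv ℝ v p a ^ 2 + fderiv ℝ v p (I • a) ^ 2 ≤ M * leviForm δ p a := by
  have hne : ∀ a ∈ Metric.sphere (0 : V) 1, a ≠ 0 := fun a ha =>
    ne_zero_of_mem_sphere one_ne_zero ⟨a, ha⟩
  have hdv : ContinuousOn (fun q : V × V => fderiv ℝ v q.1) (K ×ˢ Metric.sphere 0 1) :=
    (hv.continuousOn_fderiv_of_isOpen hD (by norm_num)).comp continuousOn_fst
      fun q hq => hKD hq.1
  have hddδ : ContinuousOn (fun q : V × V => fderiv ℝ (fderiv ℝ δ) q.1)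
      (K ×ˢ Metric.sphere 0 1) :=
    ((hδ.fderiv_of_isOpen hD (m := 1) (by norm_num)).continuousOn_fderiv_of_isOpen hD
      (by norm_num)).comp continuousOn_fst fun q hq => hKD hq.1
  have hI : ContinuousOn (fun q : V × V => I • q.2) (K ×ˢ Metric.sphere 0 1) := by fun_prop
  have hL : ContinuousOn (fun q : V × V => leviForm δ q.1 q.2) (K ×ˢ Metric.sphere 0 1) := by
    simp only [leviForm_eq_fderiv]
    exact continuousOn_const.mul (((hddδ.clm_apply continuousOn_snd).clm_apply
      continuousOn_snd).add ((hddδ.clm_apply hI).clm_apply hI))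
  have hquot : ContinuousOn (fun q : V × V =>
      (fderiv ℝ v q.1 q.2 ^ 2 + fderiv ℝ v q.1 (I • q.2) ^ 2) / leviForm δ q.1 q.2)
      (K ×ˢ Metric.sphere 0 1) :=
    (((hdv.clm_apply continuousOn_snd).pow 2).add ((hdv.clm_apply hI).pow 2)).div hL
      fun q hq => (hpos _ (hKD hq.1) _ (hne _ hq.2)).ne'
  obtain ⟨M, hM⟩ := (hK.prod (isCompact_sphere 0 1)).bddAbove_image hquot
  refine ⟨max M 1, by positivity, fun p hp a => ?_⟩
  rcases eq_or_ne a 0 with rfl | ha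
  · simp [leviForm_eq_fderiv]
  obtain ⟨b, hb, hab⟩ : ∃ b ∈ Metric.sphere (0 : V) 1, a = ‖a‖ • b :=
    ⟨‖a‖⁻¹ • a, by simp [norm_smul, ha], by simp [smul_smul, ha]⟩
  have hpb := hpos p (hKD hp) b (hne b hb)
  have hle := (div_le_iff₀ hpb).1 ((hM ⟨(p, b), ⟨hp, hb⟩, rfl⟩).trans (le_max_left M 1))
  rw [hab, leviForm_real_smul, smul_comm I ‖a‖ b]
  simp only [map_smul, smul_eq_mul]
  nlinarith [mul_le_mul_of_nonneg_left hle (sq_nonneg ‖a‖)]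

end LeviForm

/-- Lemma 3.2: if v is pluriharmonic and δ strictly plurisubharmonic (both C²) on D, then for
every precompact open E ⊆ D there is ε₀ > 0 such that e^v·θ(δ) is plurisubharmonic on
E ∩ {δ < ε₀}, where θ is the flat function expNegInvGlue. -/
theorem stmt1 {n : ℕ} (D : Set (EuclideanSpace ℂ (Fin n))) (hD : IsOpen D)
    (v δ : EuclideanSpace ℂ (Fin n) → ℝ)
    (hvC2 : ContDiffOn ℝ 2 v D)
    (hvph : ∀ p ∈ D, ∀ a : EuclideanSpace ℂ (Fin n), leviForm v p a = 0)
    (hδC2 : ContDiffOn ℝ 2 δ D)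
    (hδspsh : ∀ p ∈ D, ∀ a : EuclideanSpace ℂ (Fin n), a ≠ 0 → 0 < leviForm δ p a)
    (E : Set (EuclideanSpace ℂ (Fin n))) (hE : IsOpen E)
    (hEc : IsCompact (closure E)) (hED : closure E ⊆ D) :
    ∃ ε₀ : ℝ, 0 < ε₀ ∧
      ∀ p ∈ E, δ p < ε₀ → ∀ a : EuclideanSpace ℂ (Fin n),
        0 ≤ leviForm (fun z => Real.exp (v z) * expNegInvGlue (δ z)) p a := by
  obtain ⟨M, hM, hbound⟩ :=
    exists_sq_fderiv_le_mul_leviForm hD hvC2 hδC2 hδspsh hEc hED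
  refine ⟨1 / (M + 4), by positivity, fun p hp hpε a => ?_⟩
  have hpD := hED (subset_closure hp)
  have hnhds := hD.mem_nhds hpD
  rw [leviForm_exp_mul_expNegInvGlue (hvC2.contDiffAt hnhds) (hδC2.contDiffAt hnhds),
    hvph p hpD a]
  rcases le_or_gt (δ p) 0 with h0 | h0
  · simp [expNegInvGlue.zero_of_nonpos h0]
  refine mul_nonneg (mul_nonneg (Real.exp_pos _).le (expNegInvGlue.nonneg _)) ?_
  have hu : M + 4 < (δ p)⁻¹ := by
    rw [lt_inv_comm₀ (by positivity) h0]
    simpa using hpε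
  have hb := hbound p (subset_closure hp) a
  generalize (δ p)⁻¹ = u at hu ⊢
  generalize leviForm δ p a = L at hb ⊢
  generalize fderiv ℝ v p a = x at hb ⊢
  generalize fderiv ℝ v p (I • a) = y at hb ⊢
  generalize fderiv ℝ δ p a = s
  generalize fderiv ℝ δ p (I • a) = t
  have hcoef : M ≤ u ^ 2 - 2 * u := by nlinarith
  have hcross : 0 ≤ 4 * L + (u ^ 2 - 2 * u) * (s ^ 2 + t ^ 2) + 2 * (x * s + y * t) := by
    have h₁ := mul_le_mul_of_nonneg_right hcoef (add_nonneg (sq_nonneg s) (sq_nonneg t))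
    have h₂ : 0 ≤ M * (4 * L + M * (s ^ 2 + t ^ 2) + 2 * (x * s + y * t)) := by
      nlinarith [sq_nonneg (x + M * s), sq_nonneg (y + M * t), sq_nonneg x, sq_nonneg y]
    linarith [nonneg_of_mul_nonneg_right h₂ hM]
  linarith [mul_nonneg (sq_nonneg u) hcross, sq_nonneg x, sq_nonneg y]
end

section
/- Let X ⊆ ℂⁿ be open, let u, R, η : X → ℝ be of class C¹ with R > 0 on X, and let d ≥ 1 be an integer. Define r(z, w) := R(z)^{-1}·|w|² − 2·Re(w₁·e^{−i·u(z)}) + η(z) for (z, w) ∈ X × ℂᵈ. Then at every point (z, w) ∈ X × ℂᵈ with w ≠ (R(z)·e^{i·u(z)}, 0, …, 0), the real Fréchet differential of r at (z, w) is nonzero. -/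
open Complex

/-- Completing the square: for a unit vector `a`, the function `R⁻¹‖q‖² - 2 Re⟪a, q⟫` equals
`R⁻¹‖q - R a‖² - R`. -/
lemma inv_mul_norm_sq_sub_two_mul_re_inner {E : Type*} [NormedAddCommGroup E]
    [InnerProductSpace ℂ E] {ρ : ℝ} (hρ : ρ ≠ 0) {a : E} (ha : ‖a‖ = 1) (q : E) :
    ρ⁻¹ * ‖q‖ ^ 2 - 2 * (inner ℂ a q).re = ρ⁻¹ * ‖q - (ρ : ℂ) • a‖ ^ 2 - ρ := by
  have h := norm_sub_sq (𝕜 := ℂ) q ((ρ : ℂ) • a)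
  rw [inner_smul_right, norm_smul, ha, ← inner_conj_symm q a] at h
  rw [h]
  simp only [RCLike.re_eq_complex_re, Complex.re_ofReal_mul, Complex.conj_re, Complex.norm_real,
    Real.norm_eq_abs, mul_one, sq_abs]
  field_simp
  ring

/-- Derivative at `w` of an affine function of the squared distance to `c`, along the ray from `c`
through `w`. -/
lemma hasDerivAt_mul_norm_sq_ray {E : Type*} [NormedAddCommGroup E] [NormedSpace ℝ E]
    (ρ b : ℝ) (w c : E) :
    HasDerivAt (fun t : ℝ => ρ * ‖w + t • (w - c) - c‖ ^ 2 + b) (2 * ρ * ‖w - c‖ ^ 2) 0 := by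
  have h : (fun t : ℝ => ρ * ‖w + t • (w - c) - c‖ ^ 2 + b)
      = fun t => ρ * ((1 + t) ^ 2 * ‖w - c‖ ^ 2) + b := by
    funext t
    rw [show w + t • (w - c) - c = (1 + t) • (w - c) by module, norm_smul, mul_pow,
      Real.norm_eq_abs, sq_abs]
  rw [h]
  have h₁ := (((((hasDerivAt_id (0 : ℝ)).const_add 1).pow 2).mul_const
    (‖w - c‖ ^ 2)).const_mul ρ).add_const b
  refine h₁.congr_deriv ?_
  norm_num
  ring

/-- The defining function r(z,w) = R(z)⁻¹|w|² − 2Re(w₁e^{−iu(z)}) + η(z) has nonvanishing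
real differential at every point (z,w) with w ≠ (R(z)e^{iu(z)}, 0, …, 0). -/
theorem stmt10 {n d : ℕ} (hd : 0 < d)
    (X : Set (EuclideanSpace ℂ (Fin n))) (hX : IsOpen X)
    (u R η : EuclideanSpace ℂ (Fin n) → ℝ)
    (huC1 : ContDiffOn ℝ 1 u X) (hRC1 : ContDiffOn ℝ 1 R X) (hηC1 : ContDiffOn ℝ 1 η X)
    (hRpos : ∀ z ∈ X, 0 < R z)
    (z : EuclideanSpace ℂ (Fin n)) (hz : z ∈ X) (w : EuclideanSpace ℂ (Fin d))
    (hw : ¬ (w ⟨0, hd⟩ = (R z : ℂ) * Complex.exp (Complex.I * (u z : ℂ)) ∧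
            ∀ k : Fin d, k ≠ ⟨0, hd⟩ → w k = 0)) :
    fderiv ℝ
        (fun p : EuclideanSpace ℂ (Fin n) × EuclideanSpace ℂ (Fin d) =>
          (R p.1)⁻¹ * ‖p.2‖ ^ 2
            - 2 * (p.2 ⟨0, hd⟩ * Complex.exp (-Complex.I * (u p.1 : ℂ))).re
            + η p.1) (z, w) ≠ 0 := by
  intro h0
  have hX' := hX.mem_nhds hz
  have hu : DifferentiableAt ℝ u z := (huC1.contDiffAt hX').differentiableAt one_ne_zero
  have hR : DifferentiableAt ℝ R z := (hRC1.contDiffAt hX').differentiableAt one_ne_zero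
  have hη : DifferentiableAt ℝ η z := (hηC1.contDiffAt hX').differentiableAt one_ne_zero
  have hR0 : R z ≠ 0 := (hRpos z hz).ne'
  set f := fun p : EuclideanSpace ℂ (Fin n) × EuclideanSpace ℂ (Fin d) =>
          (R p.1)⁻¹ * ‖p.2‖ ^ 2
            - 2 * (p.2 ⟨0, hd⟩ * Complex.exp (-Complex.I * (u p.1 : ℂ))).re
            + η p.1 with hf
  have hdiff : DifferentiableAt ℝ f (z, w) := by
    have hu' : DifferentiableAt ℝ
        (fun p : EuclideanSpace ℂ (Fin n) × EuclideanSpace ℂ (Fin d) => u p.1) (z, w) :=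
      hu.comp (z, w) differentiableAt_fst
    have hR' : DifferentiableAt ℝ
        (fun p : EuclideanSpace ℂ (Fin n) × EuclideanSpace ℂ (Fin d) => R p.1) (z, w) :=
      hR.comp (z, w) differentiableAt_fst
    have hη' : DifferentiableAt ℝ
        (fun p : EuclideanSpace ℂ (Fin n) × EuclideanSpace ℂ (Fin d) => η p.1) (z, w) :=
      hη.comp (z, w) differentiableAt_fst
    have hc : DifferentiableAt ℝ
        (fun p : EuclideanSpace ℂ (Fin n) × EuclideanSpace ℂ (Fin d) => p.2 ⟨0, hd⟩) (z, w) :=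
      (PiLp.proj (𝕜 := ℝ) 2 (fun _ : Fin d => ℂ) ⟨0, hd⟩).differentiableAt.comp (z, w) differentiableAt_snd
    have he : DifferentiableAt ℝ
        (fun p : EuclideanSpace ℂ (Fin n) × EuclideanSpace ℂ (Fin d) =>
          Complex.exp (-Complex.I * (u p.1 : ℂ))) (z, w) :=
      ((Complex.ofRealCLM.differentiableAt.comp (z, w) hu').const_mul (-Complex.I)).cexp
    have hn : DifferentiableAt ℝ
        (fun p : EuclideanSpace ℂ (Fin n) × EuclideanSpace ℂ (Fin d) => ‖p.2‖ ^ 2) (z, w) :=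
      differentiableAt_snd.norm_sq ℂ
    exact (((hR'.inv hR0).mul hn).sub
      ((Complex.reCLM.differentiableAt.comp (z, w) (hc.mul he)).const_mul 2)).add hη'
  set e : ℂ := Complex.exp (Complex.I * (u z : ℂ)) with he
  set a : EuclideanSpace ℂ (Fin d) := EuclideanSpace.single ⟨0, hd⟩ e with ha
  have hconj : (starRingEnd ℂ) e = Complex.exp (-Complex.I * (u z : ℂ)) := by
    rw [he, ← Complex.exp_conj]
    simp
  have ha1 : ‖a‖ = 1 := by
    rw [ha, PiLp.norm_single, he, mul_comm, Complex.norm_exp_ofReal_mul_I]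
  have hslice (q : EuclideanSpace ℂ (Fin d)) :
      f (z, q) = (R z)⁻¹ * ‖q - (R z : ℂ) • a‖ ^ 2 + (η z - R z) := by
    have h := inv_mul_norm_sq_sub_two_mul_re_inner hR0 ha1 q
    rw [ha, EuclideanSpace.inner_single_left, hconj, mul_comm (Complex.exp _)] at h
    simp only [hf]
    rw [h]
    ring
  set v := w - (R z : ℂ) • a with hv
  have hv0 : v ≠ 0 := by
    intro h
    have hw' : w = (R z : ℂ) • a := sub_eq_zero.mp h
    refine hw ⟨?_, fun k hk => ?_⟩
    · rw [hw']
      simp [ha]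
    · rw [hw']
      simp [ha, hk]
  have hcurve : HasDerivAt (fun t : ℝ => (z, w + t • v)) (0, v) 0 := by
    have h : HasDerivAt (fun t : ℝ => w + t • v) v 0 := by
      simpa using ((hasDerivAt_id (0 : ℝ)).smul_const v).const_add w
    exact (hasDerivAt_const (0 : ℝ) z).prodMk h
  have hzero : HasDerivAt (fun t : ℝ => f (z, w + t • v)) 0 0 := by
    have h := h0 ▸ hdiff.hasFDerivAt
    have h' : HasFDerivAt f
        (0 : EuclideanSpace ℂ (Fin n) × EuclideanSpace ℂ (Fin d) →L[ℝ] ℝ)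
        (z, w + (0 : ℝ) • v) := by simpa using h
    exact h'.comp_hasDerivAt (0 : ℝ) hcurve
  simp only [hslice] at hzero
  have hne := hzero.unique (hasDerivAt_mul_norm_sq_ray (R z)⁻¹ (η z - R z) w ((R z : ℂ) • a))
  have : 2 * (R z)⁻¹ * ‖v‖ ^ 2 ≠ 0 := by
    have := norm_ne_zero_iff.mpr hv0
    positivity
  exact this hne.symm
end

section
/- Let D' ⊆ ℂⁿ be open, let F : D' → ℂ be holomorphic, let σ : D' → ℝ be strictly plurisubharmonic of class C² with σ > 0, let δ : D' → ℝ be strictly plurisubharmonic of class C², let d ≥ 1 be an integer, and let D be an open set whose closure is compact and contained in D'. Then there exist K₀ > 0 and ε₀ > 0 such that for every K ≥ K₀ the function ρ(z, w) := (σ(z) + K)·e^{Im F(z)}·|w|² − 2·Re(w₁·e^{−i·F(z)}) + e^{Im F(z)}·θ(δ(z)) is plurisubharmonic on (D ∩ {δ < ε₀}) × ℂᵈ and strictly plurisubharmonic at every point of (D ∩ {δ < ε₀}) × (ℂᵈ ∖ {0}). -/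
open Complex

theorem differentiableOn_fderiv_apply {E : Type*} [NormedAddCommGroup E]
    [NormedSpace ℂ E] [FiniteDimensional ℂ E] {f : E → ℂ} {U : Set E} (hU : IsOpen U)
    (hf : DifferentiableOn ℂ f U) (v : E) :
    DifferentiableOn ℂ (fun z => fderiv ℂ f z v) U := by
  have : ProperSpace E := FiniteDimensional.proper ℂ E
  borelize E
  intro z₀ hz₀
  obtain ⟨R', hR', hball'⟩ := Metric.nhds_basis_closedBall.mem_iff.1 (hU.mem_nhds hz₀)
  obtain ⟨R, hR, hball⟩ : ∃ R > 0, Metric.closedBall z₀ (3 * R) ⊆ U :=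
    ⟨R' / 3, by positivity, by rwa [mul_div_cancel₀ _ (by norm_num)]⟩
  obtain ⟨B, hB⟩ := (isCompact_closedBall z₀ (3 * R)).exists_bound_of_continuousOn
    (hf.continuousOn.mono hball)
  have hfd : ∀ x ∈ Metric.ball z₀ (2 * R), ‖fderiv ℂ f x‖ ≤ (B + B) / R := by
    intro x hx
    have hsub : Metric.ball x R ⊆ Metric.closedBall z₀ (3 * R) := fun y hy => by
      simp only [Metric.mem_ball, Metric.mem_closedBall] at *
      linarith [dist_triangle y x z₀]
    refine norm_fderiv_le_div_of_mapsTo_ball (hf.mono (hsub.trans hball)) (fun y hy => ?_) hR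
    rw [Metric.mem_closedBall, dist_eq_norm]
    exact (norm_sub_le _ _).trans
      (add_le_add (hB y (hsub hy)) (hB x (hsub (Metric.mem_ball_self hR))))
  obtain ⟨r, hr, hrv⟩ : ∃ r : ℝ, 0 < r ∧ r * ‖v‖ < R := by
    refine ⟨R / (‖v‖ + 1), by positivity, ?_⟩
    rw [div_mul_eq_mul_div, div_lt_iff₀ (by positivity)]
    nlinarith [norm_nonneg v]
  have hmem : ∀ z ∈ Metric.ball z₀ R, ∀ ζ : ℂ, ‖ζ‖ ≤ r → z + ζ • v ∈ Metric.ball z₀ (2 * R) := by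
    intro z hz ζ hζ
    rw [Metric.mem_ball, dist_eq_norm] at *
    calc ‖z + ζ • v - z₀‖ = ‖(z - z₀) + ζ • v‖ := by congr 1; abel
      _ ≤ ‖z - z₀‖ + ‖ζ‖ * ‖v‖ := (norm_add_le _ _).trans_eq (by rw [norm_smul])
      _ < 2 * R := by nlinarith [mul_le_mul_of_nonneg_right hζ (norm_nonneg v)]
  have hsub2 : Metric.ball z₀ (2 * R) ⊆ U := fun y hy => hball (by
    simp only [Metric.mem_ball, Metric.mem_closedBall] at *
    linarith)
  have hder : ∀ y ∈ Metric.ball z₀ (2 * R), HasFDerivAt f (fderiv ℂ f y) y := fun y hy =>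
    (hf.differentiableAt (hU.mem_nhds (hsub2 hy))).hasFDerivAt
  have hcircle : ∀ θ : ℝ, ‖circleMap 0 r θ‖ ≤ r := fun θ => by simp [abs_of_pos hr]
  have hrepr : ∀ z ∈ Metric.ball z₀ R, fderiv ℂ f z v =
      (2 * Real.pi * I : ℂ)⁻¹ • ∫ θ in (0 : ℝ)..2 * Real.pi, deriv (circleMap 0 r) θ •
        ((circleMap 0 r θ - 0) ^ 2)⁻¹ • f (z + circleMap 0 r θ • v) := by
    intro z hz
    have hline : ∀ ζ : ℂ, HasDerivAt (fun ζ : ℂ => z + ζ • v) v ζ := fun ζ => by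
      simpa using ((hasDerivAt_id ζ).smul_const v).const_add z
    have hopen : IsOpen ((fun ζ : ℂ => z + ζ • v) ⁻¹' Metric.ball z₀ (2 * R)) :=
      Metric.isOpen_ball.preimage (by fun_prop)
    have key := two_pi_I_inv_smul_circleIntegral_sub_sq_inv_smul_of_differentiable
      (f := fun ζ : ℂ => f (z + ζ • v)) (c := 0) (w₀ := 0) (R := r) hopen
      (fun ζ hζ => hmem z hz ζ (by simpa using hζ))
      (fun ζ hζ => ((hder _ hζ).comp_hasDerivAt ζ (hline ζ)).differentiableAt.differentiableWithinAt)
      (Metric.mem_ball_self hr)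
    have h0 := (hder _ (hmem z hz 0 (by simpa using hr.le))).comp_hasDerivAt 0 (hline 0)
    have h1 := h0.deriv
    simp only [Function.comp_def, zero_smul, add_zero] at h1
    rw [← h1, ← key]
    rfl
  have hint : HasFDerivAt (fun z => ∫ θ in (0 : ℝ)..2 * Real.pi, deriv (circleMap 0 r) θ •
        ((circleMap 0 r θ - 0) ^ 2)⁻¹ • f (z + circleMap 0 r θ • v))
      (∫ θ in (0 : ℝ)..2 * Real.pi, deriv (circleMap 0 r) θ •
        ((circleMap 0 r θ - 0) ^ 2)⁻¹ • fderiv ℂ f (z₀ + circleMap 0 r θ • v)) z₀ := by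
    have hker : Continuous fun θ : ℝ => ((circleMap 0 r θ - 0) ^ 2)⁻¹ := by
      refine Continuous.inv₀ (by fun_prop) fun θ => ?_
      simpa using hr.ne'
    have hker' : Continuous fun θ : ℝ => deriv (circleMap 0 r) θ := by
      simp only [deriv_circleMap]
      fun_prop
    have hcont : ∀ z ∈ Metric.ball z₀ R, Continuous fun θ : ℝ => deriv (circleMap 0 r) θ •
        ((circleMap 0 r θ - 0) ^ 2)⁻¹ • f (z + circleMap 0 r θ • v) := by
      intro z hz
      refine hker'.smul (hker.smul ?_)
      exact (hf.continuousOn.mono hsub2).comp_continuous (by fun_prop)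
        fun θ => hmem z hz _ (hcircle θ)
    refine intervalIntegral.hasFDerivAt_integral_of_dominated_of_fderiv_le
      (F' := fun z θ => deriv (circleMap 0 r) θ •
        ((circleMap 0 r θ - 0) ^ 2)⁻¹ • fderiv ℂ f (z + circleMap 0 r θ • v))
      (bound := fun _ => r * ((r ^ 2)⁻¹ * ((B + B) / R)))
      (Metric.ball_mem_nhds z₀ hR) ?_ ?_ ?_ ?_ ?_ ?_
    · filter_upwards [Metric.ball_mem_nhds z₀ hR] with z hz
      exact (hcont z hz).aestronglyMeasurable
    · exact (hcont z₀ (Metric.mem_ball_self hR)).intervalIntegrable _ _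
    · refine hker'.aestronglyMeasurable.smul (hker.aestronglyMeasurable.smul ?_)
      have hm : Measurable fun θ : ℝ => z₀ + circleMap 0 r θ • v :=
        (by fun_prop : Continuous fun θ : ℝ => z₀ + circleMap 0 r θ • v).measurable
      exact ((measurable_fderiv ℂ f).comp hm).aestronglyMeasurable
    · refine Filter.Eventually.of_forall fun θ _ z hz => ?_
      rw [norm_smul, norm_smul]
      have h := hfd _ (hmem z hz _ (hcircle θ))
      simp only [deriv_circleMap, sub_zero, norm_mul, norm_inv, norm_pow, norm_circleMap_zero,
        norm_I, mul_one, abs_of_pos hr]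
      gcongr
    · exact intervalIntegrable_const
    · refine Filter.Eventually.of_forall fun θ _ z hz => ?_
      have h := (hasFDerivAt_comp_add_right _).2 (hder _ (hmem z hz _ (hcircle θ)))
      exact (h.fun_const_smul (_ : ℂ)).fun_const_smul (_ : ℂ)
  have hsmul : DifferentiableAt ℂ (fun z => (2 * Real.pi * I : ℂ)⁻¹ • ∫ θ in (0 : ℝ)..2 * Real.pi,
      deriv (circleMap 0 r) θ • ((circleMap 0 r θ - 0) ^ 2)⁻¹ •
        f (z + circleMap 0 r θ • v)) z₀ :=
    hint.differentiableAt.fun_const_smul _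
  refine (hsmul.congr_of_eventuallyEq ?_).differentiableWithinAt
  filter_upwards [Metric.ball_mem_nhds z₀ hR] with z hz
  exact hrepr z hz

theorem contDiffOn_of_differentiableOn_complex {E : Type*} [NormedAddCommGroup E]
    [NormedSpace ℂ E] [FiniteDimensional ℂ E] {f : E → ℂ} {U : Set E} (hU : IsOpen U)
    (hf : DifferentiableOn ℂ f U) (n : ℕ) : ContDiffOn ℂ n f U := by
  induction n generalizing f with
  | zero => exact contDiffOn_zero.2 hf.continuousOn
  | succ n ih =>
    push_cast
    refine (contDiffOn_succ_iff_fderiv_apply hU.uniqueDiffOn).2 ⟨hf,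
      fun h => (WithTop.natCast_ne_top n h).elim, fun v => ?_⟩
    refine (ih (differentiableOn_fderiv_apply hU hf v)).congr fun z hz => ?_
    rw [fderivWithin_of_isOpen hU hz]

theorem exists_norm_fderiv_le_of_isCompact {𝕜 E G : Type*} [NontriviallyNormedField 𝕜]
    [NormedAddCommGroup E] [NormedSpace 𝕜 E] [NormedAddCommGroup G] [NormedSpace 𝕜 G] {f : E → G}
    {U K : Set E} (hU : IsOpen U) (hf : ContDiffOn 𝕜 1 f U) (hK : IsCompact K) (hKU : K ⊆ U) :
    ∃ M : ℝ, ∀ p ∈ K, ‖fderiv 𝕜 f p‖ ≤ M :=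
  hK.exists_bound_of_continuousOn ((hf.continuousOn_fderiv_of_isOpen hU le_rfl).mono hKU)

section Levi

variable {E : Type*} [NormedAddCommGroup E] [NormedSpace ℂ E]
  {X : Type*} [NormedAddCommGroup X] [NormedSpace ℂ X]

theorem leviForm_eq_fderiv_fderiv (f : E → ℝ) (p a : E) :
    leviForm f p a = (1 / 4) * (fderiv ℝ (fderiv ℝ f) p a a +
      fderiv ℝ (fderiv ℝ f) p (I • a) (I • a)) := by
  simp [leviForm, iteratedFDeriv_two_apply]

theorem leviForm_eq_of_hasFDerivAt {f : E → ℝ} {p : E} {L : E → E →L[ℝ] ℝ}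
    {L' : E →L[ℝ] E →L[ℝ] ℝ} (hL : ∀ᶠ x in nhds p, HasFDerivAt f (L x) x)
    (hL' : HasFDerivAt L L' p) (a : E) :
    leviForm f p a = (1 / 4) * (L' a a + L' (I • a) (I • a)) := by
  have h : fderiv ℝ f =ᶠ[nhds p] L := hL.mono fun x hx => hx.fderiv
  rw [leviForm_eq_fderiv_fderiv, h.fderiv_eq, hL'.fderiv]

theorem ContDiffAt.eventually_hasFDerivAt_fderiv {f : E → ℝ} {p : E}
    (hf : ContDiffAt ℝ 2 f p) : ∀ᶠ x in nhds p, HasFDerivAt f (fderiv ℝ f x) x :=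
  (hf.eventually (by simp)).mono fun _ hx => (hx.differentiableAt (by simp)).hasFDerivAt

theorem ContDiffAt.hasFDerivAt_fderiv_fderiv {f : E → ℝ} {p : E}
    (hf : ContDiffAt ℝ 2 f p) : HasFDerivAt (fderiv ℝ f) (fderiv ℝ (fderiv ℝ f) p) p :=
  ((hf.fderiv_right (m := 1) (by norm_num)).differentiableAt (by simp)).hasFDerivAt

theorem leviForm_add {f g : E → ℝ} {p : E} (hf : ContDiffAt ℝ 2 f p) (hg : ContDiffAt ℝ 2 g p)
    (a : E) : leviForm (fun x => f x + g x) p a = leviForm f p a + leviForm g p a := by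
  rw [leviForm_eq_of_hasFDerivAt (f := fun x => f x + g x) (hf.eventually_hasFDerivAt_fderiv.mp
    (hg.eventually_hasFDerivAt_fderiv.mono fun x hx hx' => hx'.add hx))
    (hf.hasFDerivAt_fderiv_fderiv.add hg.hasFDerivAt_fderiv_fderiv),
    leviForm_eq_fderiv_fderiv, leviForm_eq_fderiv_fderiv]
  simp only [add_apply]
  ring

theorem leviForm_mul {f g : E → ℝ} {p : E} (hf : ContDiffAt ℝ 2 f p) (hg : ContDiffAt ℝ 2 g p)
    (a : E) : leviForm (fun x => f x * g x) p a =
      f p * leviForm g p a + g p * leviForm f p a +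
        (1 / 2) * (fderiv ℝ f p a * fderiv ℝ g p a +
          fderiv ℝ f p (I • a) * fderiv ℝ g p (I • a)) := by
  have hf1 : HasFDerivAt f _ p := hf.eventually_hasFDerivAt_fderiv.self_of_nhds
  have hg1 : HasFDerivAt g _ p := hg.eventually_hasFDerivAt_fderiv.self_of_nhds
  rw [leviForm_eq_of_hasFDerivAt (f := fun x => f x * g x) (hf.eventually_hasFDerivAt_fderiv.mp
    (hg.eventually_hasFDerivAt_fderiv.mono fun x hx hx' => hx'.mul hx))
    ((hf1.smul hg.hasFDerivAt_fderiv_fderiv).add (hg1.smul hf.hasFDerivAt_fderiv_fderiv)),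
    leviForm_eq_fderiv_fderiv, leviForm_eq_fderiv_fderiv]
  simp only [add_apply, smul_apply,
    ContinuousLinearMap.smulRight_apply, smul_eq_mul]
  ring

theorem leviForm_const (c : ℝ) (p a : E) : leviForm (fun _ => c) p a = 0 := by
  simp [leviForm_eq_fderiv_fderiv]

theorem leviForm_comp_real {f : E → ℝ} {p : E} (hf : ContDiffAt ℝ 2 f p) {φ φ' : ℝ → ℝ} {φ'' : ℝ}
    (hφ : ∀ x, HasDerivAt φ (φ' x) x) (hφ' : HasDerivAt φ' φ'' (f p)) (a : E) :
    leviForm (fun x => φ (f x)) p a = φ' (f p) * leviForm f p a +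
      (φ'' / 4) * ((fderiv ℝ f p a) ^ 2 + (fderiv ℝ f p (I • a)) ^ 2) := by
  have hf1 : HasFDerivAt f _ p := hf.eventually_hasFDerivAt_fderiv.self_of_nhds
  rw [leviForm_eq_of_hasFDerivAt (f := fun x => φ (f x)) (hf.eventually_hasFDerivAt_fderiv.mono
    fun x hx => (hφ (f x)).comp_hasFDerivAt x hx)
    ((hφ'.comp_hasFDerivAt p hf1).smul hf.hasFDerivAt_fderiv_fderiv),
    leviForm_eq_fderiv_fderiv]
  simp only [add_apply, smul_apply,
    ContinuousLinearMap.smulRight_apply, smul_eq_mul, Function.comp_apply]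
  ring

theorem leviForm_comp_continuousLinearMap {f : E → ℝ} (T : X →L[ℂ] E) {p : X}
    (hf : ContDiffAt ℝ 2 f (T p)) (a : X) :
    leviForm (fun x => f (T x)) p a = leviForm f (T p) (T a) := by
  have hT : ∀ x, HasFDerivAt (fun x => T x) (T.restrictScalars ℝ) x := fun x =>
    (T.restrictScalars ℝ).hasFDerivAt
  have h1 : ∀ᶠ x in nhds p, HasFDerivAt (fun x => f (T x))
      ((ContinuousLinearMap.compL ℝ X E ℝ).flip (T.restrictScalars ℝ) (fderiv ℝ f (T x))) x :=
    (T.continuous.continuousAt.eventually hf.eventually_hasFDerivAt_fderiv).mono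
      fun x hx => hx.comp x (hT x)
  have h2 := (((ContinuousLinearMap.compL ℝ X E ℝ).flip (T.restrictScalars ℝ)).hasFDerivAt).comp p
    (HasFDerivAt.comp p hf.hasFDerivAt_fderiv_fderiv (hT p))
  rw [leviForm_eq_of_hasFDerivAt h1 h2, leviForm_eq_fderiv_fderiv]
  simp

theorem fderiv_im_apply {f : E → ℂ} {p : E} (hf : DifferentiableAt ℂ f p) (a : E) :
    fderiv ℝ (fun x => (f x).im) p a = (fderiv ℂ f p a).im := by
  have h := imCLM.hasFDerivAt.comp p (hf.hasFDerivAt.restrictScalars ℝ)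
  exact congrArg (fun L => L a) h.fderiv

theorem leviForm_re_eq_zero {f : E → ℂ} {p : E} (hf : ContDiffAt ℂ 2 f p) (a : E) :
    leviForm (fun x => (f x).re) p a = 0 := by
  have h1 : ∀ᶠ x in nhds p, HasFDerivAt (fun x => (f x).re)
      (reCLM.comp ((fderiv ℂ f x).restrictScalars ℝ)) x :=
    (hf.eventually (by simp)).mono fun x hx => reCLM.hasFDerivAt.comp x
      ((hx.differentiableAt (by simp)).hasFDerivAt.restrictScalars ℝ)
  have h2 : HasFDerivAt (fderiv ℂ f) (fderiv ℂ (fderiv ℂ f) p) p :=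
    ((hf.fderiv_right (m := 1) (by norm_num)).differentiableAt (by simp)).hasFDerivAt
  have h3 := ((ContinuousLinearMap.compL ℝ E ℂ ℝ reCLM).comp
    (ContinuousLinearMap.restrictScalarsL ℂ E ℂ ℝ ℝ)).hasFDerivAt.comp p (h2.restrictScalars ℝ)
  rw [leviForm_eq_of_hasFDerivAt h1 h3]
  simp [← mul_assoc]

theorem leviForm_im_eq_zero {f : E → ℂ} {p : E} (hf : ContDiffAt ℂ 2 f p) (a : E) :
    leviForm (fun x => (f x).im) p a = 0 := by
  have h := leviForm_re_eq_zero (contDiffAt_const.mul hf : ContDiffAt ℂ 2 (fun x => -I * f x) p) a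
  simpa using h

variable {V : Type*} [NormedAddCommGroup V] [InnerProductSpace ℂ V]

theorem leviForm_norm_sq (w b : V) : leviForm (fun w : V => ‖w‖ ^ 2) w b = ‖b‖ ^ 2 := by
  let := InnerProductSpace.rclikeToReal ℂ V
  have h (c : V) : ((2 : ℕ) • innerSL ℝ : V →L[ℝ] V →L[ℝ] ℝ) c c = 2 * ‖c‖ ^ 2 := by
    simp
  refine (leviForm_eq_of_hasFDerivAt (L := fun w => (2 : ℕ) • innerSL ℝ w)
    (L' := (2 : ℕ) • innerSL ℝ)
    (Filter.Eventually.of_forall fun x => (hasStrictFDerivAt_norm_sq x).hasFDerivAt)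
    ((2 : ℕ) • innerSL ℝ : V →L[ℝ] V →L[ℝ] ℝ).hasFDerivAt b).trans ?_
  refine (congrArg₂ (fun s t => 1 / 4 * (s + t)) (h b) (h (I • b))).trans ?_
  rw [norm_smul, norm_I]
  ring

theorem fderiv_norm_sq_apply_eq_re_inner (w b : V) :
    fderiv ℝ (fun w : V => ‖w‖ ^ 2) w b = 2 * (inner ℂ w b).re := by
  let := InnerProductSpace.rclikeToReal ℂ V
  rw [show fderiv ℝ (fun w : V => ‖w‖ ^ 2) w = (2 : ℕ) • innerSL ℝ w from
    (hasStrictFDerivAt_norm_sq w).hasFDerivAt.fderiv]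
  simp [real_inner_eq_re_inner ℂ]

theorem fderiv_comp_continuousLinearMap_apply {f : E → ℝ} (T : X →L[ℂ] E) {p : X}
    (hf : DifferentiableAt ℝ f (T p)) (a : X) :
    fderiv ℝ (fun x => f (T x)) p a = fderiv ℝ f (T p) (T a) := by
  have h := hf.hasFDerivAt.comp p (T.restrictScalars ℝ).hasFDerivAt
  exact congrArg (fun L => L a) h.fderiv

theorem ContDiffAt.comp_continuousLinearMap_complex {f : E → ℝ} (T : X →L[ℂ] E) {p : X}
    (hf : ContDiffAt ℝ 2 f (T p)) : ContDiffAt ℝ 2 (fun x => f (T x)) p :=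
  ContDiffAt.comp p hf (T.restrictScalars ℝ).contDiff.contDiffAt

theorem ContDiffAt.im_complex {F : X → ℂ} {p : X} (hF : ContDiffAt ℂ 2 F p) :
    ContDiffAt ℝ 2 (fun x => (F x).im) p :=
  imCLM.contDiff.contDiffAt.comp p (hF.restrict_scalars ℝ)

theorem ContDiffAt.re_complex {F : X → ℂ} {p : X} (hF : ContDiffAt ℂ 2 F p) :
    ContDiffAt ℝ 2 (fun x => (F x).re) p :=
  reCLM.contDiff.contDiffAt.comp p (hF.restrict_scalars ℝ)

theorem ContDiffAt.exp_im {F : X → ℂ} {p : X} (hF : ContDiffAt ℂ 2 F p) :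
    ContDiffAt ℝ 2 (fun x => Real.exp (F x).im) p :=
  hF.im_complex.exp

theorem contDiff_norm_sq_complex : ContDiff ℝ 2 fun w : V => ‖w‖ ^ 2 := by
  let := InnerProductSpace.rclikeToReal ℂ V
  exact contDiff_norm_sq ℝ

theorem fderiv_exp_im_apply {F : X → ℂ} {p : X} (hF : DifferentiableAt ℂ F p) (a : X) :
    fderiv ℝ (fun x => Real.exp (F x).im) p a = Real.exp (F p).im * (fderiv ℂ F p a).im := by
  have h : DifferentiableAt ℝ (fun x => (F x).im) p :=
    imCLM.differentiableAt.comp p (hF.restrictScalars ℝ)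
  rw [fderiv_exp h, smul_apply, fderiv_im_apply hF, smul_eq_mul]

theorem leviForm_exp_im {F : X → ℂ} {p : X} (hF : ContDiffAt ℂ 2 F p) (a : X) :
    leviForm (fun x => Real.exp (F x).im) p a =
      Real.exp (F p).im / 4 * ‖fderiv ℂ F p a‖ ^ 2 := by
  have hd : DifferentiableAt ℂ F p := hF.differentiableAt (by simp)
  rw [leviForm_comp_real hF.im_complex Real.hasDerivAt_exp (Real.hasDerivAt_exp _),
    leviForm_im_eq_zero hF, fderiv_im_apply hd, fderiv_im_apply hd, Complex.sq_norm,
    Complex.normSq_apply]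
  simp
  ring

/-- The derivative of `e^{Im F}|W|²` at `p`; the second slot of the inner product is the derivative
of the holomorphic map `e^{-iF/2} W`, up to the factor `e^{-iF/2}`. -/
theorem fderiv_exp_im_mul_norm_sq_apply {F : X → ℂ} {p : X} (hF : ContDiffAt ℂ 2 F p)
    (W : X →L[ℂ] V) (a : X) :
    fderiv ℝ (fun x => Real.exp (F x).im * ‖W x‖ ^ 2) p a = Real.exp (F p).im *
      (2 * (inner ℂ (W p) (W a - (I / 2 * fderiv ℂ F p a) • W p)).re) := by
  have hd : DifferentiableAt ℂ F p := hF.differentiableAt (by simp)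
  have hn := (contDiff_norm_sq_complex (V := V)).contDiffAt (x := W p)
  rw [fderiv_fun_mul (hF.exp_im.differentiableAt (by simp))
    ((hn.comp_continuousLinearMap_complex W).differentiableAt (by simp))]
  rw [add_apply, smul_apply, smul_apply, fderiv_exp_im_apply hd,
    fderiv_comp_continuousLinearMap_apply (f := fun w : V => ‖w‖ ^ 2) W
      (hn.differentiableAt (by simp)), fderiv_norm_sq_apply_eq_re_inner, inner_sub_right,
    inner_smul_right, inner_self_eq_norm_sq_to_K]
  simp [← ofReal_pow]
  ring

theorem leviForm_exp_im_mul_norm_sq {F : X → ℂ} {p : X} (hF : ContDiffAt ℂ 2 F p)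
    (W : X →L[ℂ] V) (a : X) :
    leviForm (fun x => Real.exp (F x).im * ‖W x‖ ^ 2) p a = Real.exp (F p).im *
      ‖W a - (I / 2 * fderiv ℂ F p a) • W p‖ ^ 2 := by
  have hd : DifferentiableAt ℂ F p := hF.differentiableAt (by simp)
  have hn := (contDiff_norm_sq_complex (V := V)).contDiffAt (x := W p)
  rw [leviForm_mul hF.exp_im (hn.comp_continuousLinearMap_complex W), leviForm_exp_im hF,
    leviForm_comp_continuousLinearMap (f := fun w : V => ‖w‖ ^ 2) W hn, leviForm_norm_sq,
    fderiv_exp_im_apply hd, fderiv_exp_im_apply hd,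
    fderiv_comp_continuousLinearMap_apply (f := fun w : V => ‖w‖ ^ 2) W
      (hn.differentiableAt (by simp)),
    fderiv_comp_continuousLinearMap_apply (f := fun w : V => ‖w‖ ^ 2) W
      (hn.differentiableAt (by simp)), fderiv_norm_sq_apply_eq_re_inner,
    fderiv_norm_sq_apply_eq_re_inner, norm_sub_sq (𝕜 := ℂ), norm_smul, mul_pow]
  simp only [map_smul, inner_smul_right, norm_mul, mul_pow, RCLike.re_to_complex]
  rw [← inner_conj_symm (W a) (W p)]
  generalize inner ℂ (W p) (W a) = c
  simp
  ring

/-- Lower bound for the Levi form of `S e^{Im F}|W|²`. -/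
theorem le_leviForm_mul_exp_im_mul_norm_sq {F : X → ℂ} {p : X} (hF : ContDiffAt ℂ 2 F p)
    (W : X →L[ℂ] V) {S : X → ℝ} (hS : ContDiffAt ℝ 2 S p) {a : X} {m : ℝ}
    (h₁ : |fderiv ℝ S p a| ≤ m) (h₂ : |fderiv ℝ S p (I • a)| ≤ m) :
    Real.exp (F p).im * (leviForm S p a * ‖W p‖ ^ 2 +
        S p * ‖W a - (I / 2 * fderiv ℂ F p a) • W p‖ ^ 2 -
        2 * m * (‖W p‖ * ‖W a - (I / 2 * fderiv ℂ F p a) • W p‖)) ≤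
      leviForm (fun x => S x * (Real.exp (F x).im * ‖W x‖ ^ 2)) p a := by
  have hn := (contDiff_norm_sq_complex (V := V)).contDiffAt (x := W p)
  rw [leviForm_mul hS (hF.exp_im.mul (hn.comp_continuousLinearMap_complex W)),
    leviForm_exp_im_mul_norm_sq hF, fderiv_exp_im_mul_norm_sq_apply hF,
    fderiv_exp_im_mul_norm_sq_apply hF,
    show W (I • a) - (I / 2 * fderiv ℂ F p (I • a)) • W p =
      I • (W a - (I / 2 * fderiv ℂ F p a) • W p) by
        simp only [map_smul, smul_sub, smul_smul, smul_eq_mul]; ring_nf,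
    inner_smul_right]
  set v := W a - (I / 2 * fderiv ℂ F p a) • W p
  have hb : ‖inner ℂ (W p) v‖ ≤ ‖W p‖ * ‖v‖ := norm_inner_le_norm _ _
  have hm : 0 ≤ m := (abs_nonneg _).trans h₁
  have e₁ : |fderiv ℝ S p a * (inner ℂ (W p) v).re| ≤ m * (‖W p‖ * ‖v‖) := by
    rw [abs_mul]
    exact mul_le_mul h₁ ((abs_re_le_norm _).trans hb) (abs_nonneg _) hm
  have e₂ : |fderiv ℝ S p (I • a) * (inner ℂ (W p) v).im| ≤ m * (‖W p‖ * ‖v‖) := by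
    rw [abs_mul]
    exact mul_le_mul h₂ ((abs_im_le_norm _).trans hb) (abs_nonneg _) hm
  have hIre : (I * inner ℂ (W p) v).re = -(inner ℂ (W p) v).im := by simp
  rw [hIre]
  have key : 0 ≤ Real.exp (F p).im * (2 * m * (‖W p‖ * ‖v‖) +
      fderiv ℝ S p a * (inner ℂ (W p) v).re - fderiv ℝ S p (I • a) * (inner ℂ (W p) v).im) :=
    mul_nonneg (Real.exp_pos _).le (by linarith [neg_le_of_abs_le e₁, le_of_abs_le e₂])
  linarith

theorem hasDerivAt_expNegInvGlue (x : ℝ) :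
    HasDerivAt expNegInvGlue (x⁻¹ ^ 2 * expNegInvGlue x) x := by
  simpa using expNegInvGlue.hasDerivAt_polynomial_eval_inv_mul 1 x

theorem hasDerivAt_inv_sq_mul_expNegInvGlue (x : ℝ) :
    HasDerivAt (fun x => x⁻¹ ^ 2 * expNegInvGlue x)
      (x⁻¹ ^ 2 * (x⁻¹ ^ 2 - 2 * x⁻¹) * expNegInvGlue x) x := by
  have h := expNegInvGlue.hasDerivAt_polynomial_eval_inv_mul (Polynomial.X ^ 2) x
  simp only [Polynomial.eval_mul, Polynomial.eval_sub, Polynomial.eval_pow, Polynomial.eval_X,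
    Polynomial.derivative_X_pow] at h
  simpa using h

/-- `e^{Im F} θ(Δ)` has nonnegative Levi form where `Δ` is small. -/
theorem leviForm_exp_im_mul_expNegInvGlue_nonneg {F : X → ℂ} {p : X} (hF : ContDiffAt ℂ 2 F p)
    {Δ : X → ℝ} (hΔ : ContDiffAt ℝ 2 Δ p) {a : X} (h_small : Δ p ≤ 1 / 4)
    (h : 0 < Δ p → Δ p ^ 2 * ‖fderiv ℂ F p a‖ ^ 2 ≤ 4 * leviForm Δ p a) :
    0 ≤ leviForm (fun x => Real.exp (F x).im * expNegInvGlue (Δ x)) p a := by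
  have hd : DifferentiableAt ℂ F p := hF.differentiableAt (by simp)
  have hθ : ContDiffAt ℝ 2 (fun x => expNegInvGlue (Δ x)) p :=
    (expNegInvGlue.contDiff (n := 2)).contDiffAt.comp p hΔ
  have hDθ : ∀ b, fderiv ℝ (fun x => expNegInvGlue (Δ x)) p b =
      (Δ p)⁻¹ ^ 2 * expNegInvGlue (Δ p) * fderiv ℝ Δ p b := fun b => by
    have h := (hasDerivAt_expNegInvGlue (Δ p)).comp_hasFDerivAt p
      (hΔ.differentiableAt (by simp)).hasFDerivAt
    exact congrArg (fun L => L b) h.fderiv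
  rw [leviForm_mul hF.exp_im hθ, leviForm_exp_im hF, leviForm_comp_real hΔ hasDerivAt_expNegInvGlue
    (hasDerivAt_inv_sq_mul_expNegInvGlue _), hDθ, hDθ, fderiv_exp_im_apply hd,
    fderiv_exp_im_apply hd, Complex.sq_norm, Complex.normSq_apply]
  rcases le_or_gt (Δ p) 0 with h0 | h0
  · simp [expNegInvGlue.zero_of_nonpos h0]
  have h := h h0
  rw [Complex.sq_norm, Complex.normSq_apply] at h
  have hθ0 := expNegInvGlue.nonneg (Δ p)
  have hIim : (fderiv ℂ F p (I • a)).im = (fderiv ℂ F p a).re := by simp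
  rw [hIim]
  set α := (fderiv ℂ F p a).re
  set β := (fderiv ℂ F p a).im
  set p₁ := fderiv ℝ Δ p a
  set p₂ := fderiv ℝ Δ p (I • a)
  set y := (Δ p)⁻¹ with hy
  have hy4 : 4 ≤ y := by
    rw [hy, le_inv_comm₀ (by norm_num) h0]
    simpa using h_small
  have hL : α * α + β * β ≤ 4 * (y ^ 2 * leviForm Δ p a) := by
    have h2 := mul_le_mul_of_nonneg_left h (sq_nonneg y)
    have h3 : y * Δ p = 1 := inv_mul_cancel₀ h0.ne'
    calc α * α + β * β = (y * Δ p) ^ 2 * (α * α + β * β) := by rw [h3]; ring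
      _ ≤ _ := by linarith
  have hsq : ∀ q b : ℝ, -(b * b) ≤ y ^ 2 * (y ^ 2 - 2 * y) * q ^ 2 + 2 * (y ^ 2 * q) * b + b * b := by
    intro q b
    nlinarith [sq_nonneg (y ^ 2 * q + 2 * b), mul_nonneg (sub_nonneg.2 hy4)
      (mul_nonneg (pow_nonneg (by linarith : 0 ≤ y) 3) (sq_nonneg q))]
  have key : 0 ≤ Real.exp (F p).im * expNegInvGlue (Δ p) * (4 * (y ^ 2 * leviForm Δ p a) +
      (y ^ 2 * (y ^ 2 - 2 * y) * p₁ ^ 2 + 2 * (y ^ 2 * p₁) * β + β * β) +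
      (y ^ 2 * (y ^ 2 - 2 * y) * p₂ ^ 2 + 2 * (y ^ 2 * p₂) * α + α * α)) :=
    mul_nonneg (mul_nonneg (Real.exp_pos _).le hθ0) (by linarith [hsq p₁ β, hsq p₂ α])
  linarith

theorem leviForm_smul_real (f : E → ℝ) (p : E) (t : ℝ) (a : E) :
    leviForm f p (t • a) = t ^ 2 * leviForm f p a := by
  rw [leviForm_eq_fderiv_fderiv, leviForm_eq_fderiv_fderiv, smul_comm I t a]
  simp only [map_smul, smul_apply, smul_eq_mul]
  ring

theorem ContDiffOn.continuousOn_leviForm {f : E → ℝ} {U : Set E} (hU : IsOpen U)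
    (hf : ContDiffOn ℝ 2 f U) :
    ContinuousOn (fun q : E × E => leviForm f q.1 q.2) (U ×ˢ Set.univ) := by
  have h1 : ContDiffOn ℝ 1 (fderiv ℝ f) U := hf.fderiv_of_isOpen hU (by norm_num)
  have h2 : ContinuousOn (fderiv ℝ (fderiv ℝ f)) U := h1.continuousOn_fderiv_of_isOpen hU le_rfl
  have h3 : ContinuousOn (fun q : E × E => fderiv ℝ (fderiv ℝ f) q.1) (U ×ˢ Set.univ) :=
    h2.comp continuousOn_fst fun q hq => hq.1
  have h4 : ContinuousOn (fun q : E × E => I • q.2) (U ×ˢ Set.univ) := by fun_prop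
  simp only [leviForm_eq_fderiv_fderiv]
  exact continuousOn_const.mul (((h3.clm_apply continuousOn_snd).clm_apply continuousOn_snd).add
    ((h3.clm_apply h4).clm_apply h4))

/-- A strictly plurisubharmonic function has a uniformly positive Levi form on compact sets. -/
theorem exists_pos_mul_norm_sq_le_leviForm [FiniteDimensional ℂ E] {f : E → ℝ} {U K : Set E}
    (hU : IsOpen U) (hf : ContDiffOn ℝ 2 f U)
    (hpos : ∀ p ∈ U, ∀ a : E, a ≠ 0 → 0 < leviForm f p a) (hK : IsCompact K) (hKU : K ⊆ U) :
    ∃ c : ℝ, 0 < c ∧ ∀ p ∈ K, ∀ a : E, c * ‖a‖ ^ 2 ≤ leviForm f p a := by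
  have : ProperSpace E := FiniteDimensional.proper ℂ E
  obtain ⟨c, hc, h⟩ := (hK.prod (isCompact_sphere (0 : E) 1)).exists_forall_le'
    ((hf.continuousOn_leviForm hU).mono (Set.prod_mono hKU (Set.subset_univ _))) (a := 0)
    fun q hq => hpos q.1 (hKU hq.1) q.2 (ne_zero_of_mem_unit_sphere ⟨q.2, hq.2⟩)
  refine ⟨c, hc, fun p hp a => ?_⟩
  rcases eq_or_ne a 0 with rfl | ha
  · simp [leviForm_eq_fderiv_fderiv]
  have hn : ‖a‖ ≠ 0 := norm_ne_zero_iff.2 ha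
  have hu := h (p, ‖a‖⁻¹ • a) ⟨hp, by simp [norm_smul, hn]⟩
  rw [leviForm_smul_real, inv_pow, le_inv_mul_iff₀ (by positivity)] at hu
  linarith

theorem quadratic_form_pos {c S m x y : ℝ} (hc : 0 < c) (hdet : m ^ 2 < c * S)
    (hxy : x ≠ 0 ∨ y ≠ 0) : 0 < c * x ^ 2 + S * y ^ 2 - 2 * m * (x * y) := by
  have h : 0 < c * (c * x ^ 2 + S * y ^ 2 - 2 * m * (x * y)) := by
    rw [show c * (c * x ^ 2 + S * y ^ 2 - 2 * m * (x * y)) =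
      (c * x - m * y) ^ 2 + (c * S - m ^ 2) * y ^ 2 by ring]
    rcases eq_or_ne y 0 with rfl | hy
    · have hx : x ≠ 0 := by simpa using hxy
      simp only [mul_zero, sub_zero]
      positivity
    · have := mul_pos (sub_pos.2 hdet) (pow_pos (abs_pos.2 hy) 2)
      rw [sq_abs] at this
      linarith [sq_nonneg (c * x - m * y)]
  exact pos_of_mul_pos_right h hc.le

/-- The local defining function of the worm. -/
noncomputable def wormFunction (σ δ : E → ℝ) (F : E → ℂ) (ℓ : V →L[ℂ] ℂ) (K : ℝ) (p : E × V) : ℝ :=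
  (σ p.1 + K) * Real.exp (F p.1).im * ‖p.2‖ ^ 2 - 2 * (ℓ p.2 * exp (-I * F p.1)).re +
    Real.exp (F p.1).im * expNegInvGlue (δ p.1)

theorem le_leviForm_wormFunction {σ δ : E → ℝ} {F : E → ℂ} (ℓ : V →L[ℂ] ℂ) {K c M : ℝ} {z : E}
    (hF : ContDiffAt ℂ 2 F z) (hσ : ContDiffAt ℝ 2 σ z) (hδ : ContDiffAt ℝ 2 δ z)
    (hcσ : ∀ a, c * ‖a‖ ^ 2 ≤ leviForm σ z a) (hMσ : ‖fderiv ℝ σ z‖ ≤ M)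
    (h_small : δ z ≤ 1 / 4)
    (hδF : ∀ a, 0 < δ z → δ z ^ 2 * ‖fderiv ℂ F z a‖ ^ 2 ≤ 4 * leviForm δ z a) (w : V) (a : E)
    (b : V) :
    Real.exp (F z).im * (c * (‖a‖ * ‖w‖) ^ 2 +
        (σ z + K) * ‖b - (I / 2 * fderiv ℂ F z a) • w‖ ^ 2 -
        2 * M * ((‖a‖ * ‖w‖) * ‖b - (I / 2 * fderiv ℂ F z a) • w‖)) ≤
      leviForm (wormFunction σ δ F ℓ K) (z, w) (a, b) := by
  let π := ContinuousLinearMap.fst ℂ E V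
  let W := ContinuousLinearMap.snd ℂ E V
  have hFX : ContDiffAt ℂ 2 (fun p => F (π p)) (z, w) :=
    ContDiffAt.comp (z, w) (g := F) (f := π) hF π.contDiff.contDiffAt
  have hDF (a : E × V) : fderiv ℂ (fun p => F (π p)) (z, w) a = fderiv ℂ F z a.1 := by
    have h := HasFDerivAt.comp (z, w) (g := F) (f := π)
      (hF.differentiableAt (by simp)).hasFDerivAt π.hasFDerivAt
    exact congrArg (fun L => L a) h.fderiv
  have hσX : ContDiffAt ℝ 2 (fun p => σ (π p)) (z, w) :=
    ContDiffAt.comp_continuousLinearMap_complex π hσ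
  have hδX : ContDiffAt ℝ 2 (fun p => δ (π p)) (z, w) :=
    ContDiffAt.comp_continuousLinearMap_complex π hδ
  have hSX : ContDiffAt ℝ 2 (fun p => σ (π p) + K) (z, w) := hσX.add contDiffAt_const
  have hHX : ContDiffAt ℂ 2 (fun p => -2 * (ℓ (W p) * exp (-I * F (π p)))) (z, w) :=
    contDiffAt_const.mul (((ℓ.comp W).contDiff.contDiffAt).mul (contDiffAt_const.mul hFX).cexp)
  have hDS (b : E × V) : fderiv ℝ (fun p => σ (π p) + K) (z, w) b = fderiv ℝ σ z b.1 := by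
    rw [fderiv_add_const]
    exact fderiv_comp_continuousLinearMap_apply π (hσ.differentiableAt (by simp)) b
  have hLS : leviForm (fun p => σ (π p) + K) (z, w) (a, b) = leviForm σ z a := by
    rw [leviForm_add hσX contDiffAt_const, leviForm_const, add_zero]
    exact leviForm_comp_continuousLinearMap π hσ _
  have hnW : ContDiffAt ℝ 2 (fun p => ‖W p‖ ^ 2) (z, w) :=
    (contDiff_norm_sq_complex (V := V)).contDiffAt.comp_continuousLinearMap_complex W
  have hθX : ContDiffAt ℝ 2 (fun p => expNegInvGlue (δ (π p))) (z, w) :=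
    (expNegInvGlue.contDiff (n := 2)).contDiffAt.comp (z, w) hδX
  have heq : wormFunction σ δ F ℓ K = fun p : E × V =>
      ((σ (π p) + K) * (Real.exp (F (π p)).im * ‖W p‖ ^ 2) +
        (-2 * (ℓ (W p) * exp (-I * F (π p)))).re) +
        Real.exp (F (π p)).im * expNegInvGlue (δ (π p)) := by
    funext p
    simp only [wormFunction, π, W, ContinuousLinearMap.coe_fst', ContinuousLinearMap.coe_snd']
    rw [show ((-2 : ℂ) * (ℓ p.2 * exp (-I * F p.1))).re = -2 * (ℓ p.2 * exp (-I * F p.1)).re by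
      simpa only [ofReal_neg, ofReal_ofNat] using re_ofReal_mul (-2) (ℓ p.2 * exp (-I * F p.1))]
    ring
  have hbound (b : E) (hb : ‖b‖ = ‖a‖) : |fderiv ℝ σ z b| ≤ M * ‖a‖ := by
    rw [← hb]
    exact ((fderiv ℝ σ z).le_opNorm b).trans (by gcongr)
  have h1 := le_leviForm_mul_exp_im_mul_norm_sq hFX W hSX (a := (a, b)) (m := M * ‖a‖)
    (by rw [hDS]; exact hbound a rfl) (by rw [hDS]; exact hbound (I • a) (by simp [norm_smul]))
  have h2 := leviForm_exp_im_mul_expNegInvGlue_nonneg hFX hδX (a := (a, b)) h_small (by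
    rw [hDF, leviForm_comp_continuousLinearMap (f := δ) (p := (z, w)) π hδ]
    exact hδF a)
  rw [heq, leviForm_add (((hSX.mul (hFX.exp_im.mul hnW))).add hHX.re_complex)
    (hFX.exp_im.mul hθX), leviForm_add (hSX.mul (hFX.exp_im.mul hnW)) hHX.re_complex,
    leviForm_re_eq_zero hHX]
  rw [hLS, hDF] at h1
  have h3 : Real.exp (F z).im * (c * ‖a‖ ^ 2 * ‖w‖ ^ 2) ≤
      Real.exp (F z).im * (leviForm σ z a * ‖w‖ ^ 2) := by
    gcongr
    exact hcσ a
  simp only [π, W, ContinuousLinearMap.coe_fst', ContinuousLinearMap.coe_snd'] at h1 h2 ⊢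
  linarith

end Levi

theorem exists_wormFunction_leviForm_nonneg {E V : Type*} [NormedAddCommGroup E] [NormedSpace ℂ E]
    [FiniteDimensional ℂ E] [NormedAddCommGroup V] [InnerProductSpace ℂ V] (ℓ : V →L[ℂ] ℂ)
    {D' D : Set E} (hD' : IsOpen D') {F : E → ℂ} (hF : DifferentiableOn ℂ F D')
    {σ : E → ℝ} (hσC2 : ContDiffOn ℝ 2 σ D') (hσpos : ∀ p ∈ D', 0 < σ p)
    (hσspsh : ∀ p ∈ D', ∀ a : E, a ≠ 0 → 0 < leviForm σ p a)
    {δ : E → ℝ} (hδC2 : ContDiffOn ℝ 2 δ D')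
    (hδspsh : ∀ p ∈ D', ∀ a : E, a ≠ 0 → 0 < leviForm δ p a)
    (hDc : IsCompact (closure D)) (hDD' : closure D ⊆ D') :
    ∃ K₀ : ℝ, 0 < K₀ ∧ ∃ ε₀ : ℝ, 0 < ε₀ ∧ ∀ K : ℝ, K₀ ≤ K →
      (∀ z ∈ D, δ z < ε₀ → ∀ w : V, ∀ ab : E × V,
        0 ≤ leviForm (wormFunction σ δ F ℓ K) (z, w) ab) ∧
      (∀ z ∈ D, δ z < ε₀ → ∀ w : V, w ≠ 0 → ∀ ab : E × V, ab ≠ 0 →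
        0 < leviForm (wormFunction σ δ F ℓ K) (z, w) ab) := by
  have hFC2 : ContDiffOn ℂ 2 F D' := contDiffOn_of_differentiableOn_complex hD' hF 2
  obtain ⟨c, hc, hcσ⟩ := exists_pos_mul_norm_sq_le_leviForm hD' hσC2 hσspsh hDc hDD'
  obtain ⟨c', hc', hcδ⟩ := exists_pos_mul_norm_sq_le_leviForm hD' hδC2 hδspsh hDc hDD'
  obtain ⟨M, hM⟩ := exists_norm_fderiv_le_of_isCompact hD' (hσC2.of_le one_le_two) hDc hDD'
  obtain ⟨N, hN⟩ := exists_norm_fderiv_le_of_isCompact hD' (hFC2.of_le one_le_two) hDc hDD'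
  have hK₀ : 0 < M ^ 2 / c + 1 := by positivity
  have hε₀ : 0 < min (1 / 4) (4 * c' / (N ^ 2 + 1)) := lt_min (by norm_num) (by positivity)
  refine ⟨M ^ 2 / c + 1, hK₀, min (1 / 4) (4 * c' / (N ^ 2 + 1)), hε₀, fun K hK => ?_⟩
  have hle (z : E) (hz : z ∈ D) (hδz : δ z < min (1 / 4) (4 * c' / (N ^ 2 + 1))) (w : V)
      (a : E) (b : V) := by
    have hzc := subset_closure hz
    have hzD' := hDD' hzc
    have hnhds := hD'.mem_nhds hzD'
    refine le_leviForm_wormFunction ℓ (K := K) (hFC2.contDiffAt hnhds) (hσC2.contDiffAt hnhds)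
      (hδC2.contDiffAt hnhds) (hcσ z hzc) (hM z hzc) (hδz.trans_le (min_le_left _ _)).le
      (fun a h0 => ?_) w a b
    have h4 : δ z < 1 / 4 := hδz.trans_le (min_le_left _ _)
    have hc4 := hδz.trans_le (min_le_right _ _)
    rw [lt_div_iff₀ (by positivity)] at hc4
    have hFa : ‖fderiv ℂ F z a‖ ^ 2 ≤ N ^ 2 * ‖a‖ ^ 2 := by
      rw [← mul_pow]
      gcongr
      exact ((fderiv ℂ F z).le_opNorm a).trans (by gcongr; exact hN z hzc)
    have hδN : δ z ^ 2 * N ^ 2 ≤ 4 * c' := by nlinarith [sq_nonneg N]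
    calc δ z ^ 2 * ‖fderiv ℂ F z a‖ ^ 2 ≤ δ z ^ 2 * (N ^ 2 * ‖a‖ ^ 2) := by gcongr
      _ = δ z ^ 2 * N ^ 2 * ‖a‖ ^ 2 := by ring
      _ ≤ 4 * c' * ‖a‖ ^ 2 := by gcongr
      _ ≤ 4 * leviForm δ z a := by linarith [hcδ z hzc a]
  have hdet (z : E) (hz : z ∈ D) : M ^ 2 < c * (σ z + K) := by
    have h1 := hσpos z (hDD' (subset_closure hz))
    have h2 : M ^ 2 / c < σ z + K := by linarith
    rwa [div_lt_iff₀' hc] at h2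
  constructor
  · rintro z hz hδz w ⟨a, b⟩
    refine le_trans (mul_nonneg (Real.exp_pos _).le ?_) (hle z hz hδz w a b)
    by_cases h : ‖a‖ * ‖w‖ ≠ 0 ∨ ‖b - (I / 2 * fderiv ℂ F z a) • w‖ ≠ 0
    · exact (quadratic_form_pos hc (hdet z hz) h).le
    · push Not at h
      simp [h.1, h.2]
  · rintro z hz hδz w hw ⟨a, b⟩ hab
    refine lt_of_lt_of_le (mul_pos (Real.exp_pos _) ?_) (hle z hz hδz w a b)
    refine quadratic_form_pos hc (hdet z hz) ?_
    rcases eq_or_ne a 0 with rfl | ha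
    · right
      simpa using hab
    · left
      simp [ha, hw]

/-- Local defining function of the higher-dimensional worm: for F holomorphic, σ > 0 strictly
plurisubharmonic, δ strictly plurisubharmonic on D', and D precompact open in D', there are
K₀ > 0 and ε₀ > 0 such that for all K ≥ K₀ the function
ρ(z,w) = (σ(z)+K)e^{Im F(z)}|w|² − 2Re(w₁e^{−iF(z)}) + e^{Im F(z)}θ(δ(z))
is plurisubharmonic on (D ∩ {δ < ε₀}) × ℂᵈ and strictly plurisubharmonic on
(D ∩ {δ < ε₀}) × (ℂᵈ \ {0}). -/
theorem stmt14 {n d : ℕ} (hd : 0 < d)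
    (D' : Set (EuclideanSpace ℂ (Fin n))) (hD' : IsOpen D')
    (F : EuclideanSpace ℂ (Fin n) → ℂ) (hF : DifferentiableOn ℂ F D')
    (σ : EuclideanSpace ℂ (Fin n) → ℝ) (hσC2 : ContDiffOn ℝ 2 σ D')
    (hσpos : ∀ p ∈ D', 0 < σ p)
    (hσspsh : ∀ p ∈ D', ∀ a : EuclideanSpace ℂ (Fin n), a ≠ 0 → 0 < leviForm σ p a)
    (δ : EuclideanSpace ℂ (Fin n) → ℝ) (hδC2 : ContDiffOn ℝ 2 δ D')
    (hδspsh : ∀ p ∈ D', ∀ a : EuclideanSpace ℂ (Fin n), a ≠ 0 → 0 < leviForm δ p a)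
    (D : Set (EuclideanSpace ℂ (Fin n))) (hD : IsOpen D)
    (hDc : IsCompact (closure D)) (hDD' : closure D ⊆ D') :
    ∃ K₀ : ℝ, 0 < K₀ ∧ ∃ ε₀ : ℝ, 0 < ε₀ ∧
      ∀ K : ℝ, K₀ ≤ K →
        (∀ z ∈ D, δ z < ε₀ → ∀ w : EuclideanSpace ℂ (Fin d),
          ∀ ab : EuclideanSpace ℂ (Fin n) × EuclideanSpace ℂ (Fin d),
            0 ≤ leviForm
              (fun p : EuclideanSpace ℂ (Fin n) × EuclideanSpace ℂ (Fin d) =>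
                (σ p.1 + K) * Real.exp ((F p.1).im) * ‖p.2‖ ^ 2
                  - 2 * (p.2 ⟨0, hd⟩ * Complex.exp (-Complex.I * F p.1)).re
                  + Real.exp ((F p.1).im) * expNegInvGlue (δ p.1)) (z, w) ab) ∧
        (∀ z ∈ D, δ z < ε₀ → ∀ w : EuclideanSpace ℂ (Fin d), w ≠ 0 →
          ∀ ab : EuclideanSpace ℂ (Fin n) × EuclideanSpace ℂ (Fin d), ab ≠ 0 →
            0 < leviForm
              (fun p : EuclideanSpace ℂ (Fin n) × EuclideanSpace ℂ (Fin d) =>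
                (σ p.1 + K) * Real.exp ((F p.1).im) * ‖p.2‖ ^ 2
                  - 2 * (p.2 ⟨0, hd⟩ * Complex.exp (-Complex.I * F p.1)).re
                  + Real.exp ((F p.1).im) * expNegInvGlue (δ p.1)) (z, w) ab) := by
  obtain ⟨K₀, hK₀, ε₀, hε₀, h⟩ := exists_wormFunction_leviForm_nonneg
    (EuclideanSpace.proj ⟨0, hd⟩ : EuclideanSpace ℂ (Fin d) →L[ℂ] ℂ) hD' hF hσC2 hσpos hσspsh
    hδC2 hδspsh hDc hDD'
  refine ⟨K₀, hK₀, ε₀, hε₀, fun K hK => ?_⟩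
  have h := h K hK
  unfold wormFunction at h
  simp only [PiLp.proj_apply] at h
  exact h
end
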